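/- arXiv:0908.0135 — 6 statements merged into one kernel-verified Lean document; each statement's English description precedes it below -/
import Mathlib

section
/- Let k ≥ 1, let A be a unital C*-algebra, and let c_1, …, c_k, s ∈ A satisfy the relations R_k. Then the element b := Σ_{j=1}^k c_j* s s* c_j + s* s commutes with each c_j (j = 1, …, k) and with s; in particular b lies in the center of the C*-subalgebra generated by {c_1, …, c_k, s}. -/
/- Statement 4: if c_1, …, c_k, s satisfy the relations R_k in a unital
   C*-algebra A, then b = Σ_j c_j* s s* c_j + s* s commutes with each c_j and
   with s, and lies in the center of the C*-subalgebra generated by them. -/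

open scoped ComplexOrder

/-- The relations `R_k` (0-based indexing: `c 0` is `c_1`):
`c_1 ≥ 0`, `c_i c_j* = δ_{i,j} c_1²`, `Σ_j c_j* c_j + s* s = 1`, `c_1 s = s`. -/
def SatisfiesRk {A : Type*} [CStarAlgebra A] [PartialOrder A] [StarOrderedRing A]
    {k : ℕ} [NeZero k] (c : Fin k → A) (s : A) : Prop :=
  0 ≤ c 0 ∧
  (∀ i j : Fin k, c i * star (c j) = if i = j then c 0 ^ 2 else 0) ∧
  (∑ j : Fin k, star (c j) * c j) + star s * s = 1 ∧
  c 0 * s = s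

namespace SatisfiesRk

variable {A : Type*} [CStarAlgebra A] [PartialOrder A] [StarOrderedRing A]
  {k : ℕ} [NeZero k] {c : Fin k → A} {s : A}

lemma star_zero (h : SatisfiesRk c s) : star (c 0) = c 0 :=
  (IsSelfAdjoint.of_nonneg h.1).star_eq

lemma mul_zero_of_ne (h : SatisfiesRk c s) {j : Fin k} (hj : j ≠ 0) : c j * c 0 = 0 := by
  simpa [h.star_zero, hj] using h.2.1 j 0

lemma mul_eq_zero_of_ne (h : SatisfiesRk c s) {j : Fin k} (hj : j ≠ 0) (i : Fin k) :
    c j * c i = 0 := by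
  rw [← CStarRing.mul_star_self_eq_zero_iff, star_mul]
  calc c j * c i * (star (c i) * star (c j))
      = c j * (c i * star (c i)) * star (c j) := by simp only [mul_assoc]
    _ = c j * c 0 * c 0 * star (c j) := by simp [h.2.1 i i, pow_two, mul_assoc]
    _ = 0 := by simp [h.mul_zero_of_ne hj]

lemma mul_s_of_ne (h : SatisfiesRk c s) {j : Fin k} (hj : j ≠ 0) : c j * s = 0 := by
  rw [← h.2.2.2, ← mul_assoc, h.mul_zero_of_ne hj, zero_mul]

lemma star_s_mul (h : SatisfiesRk c s) : star s * c 0 = star s := by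
  simpa [h.star_zero] using congrArg star h.2.2.2

lemma star_mul_self_s (h : SatisfiesRk c s) :
    star s * s = 1 - ∑ j, star (c j) * c j :=
  eq_sub_of_add_eq' h.2.2.1

lemma commute_star_mul_self (h : SatisfiesRk c s) (i : Fin k) :
    Commute (star s * s) (c i) := by
  have hl : ∑ j, star (c j) * c j * c i = c 0 * c 0 * c i := by
    rw [Finset.sum_eq_single 0]
    · rw [h.star_zero]
    · intro j _ hj
      rw [mul_assoc, h.mul_eq_zero_of_ne hj, mul_zero]
    · simp
  have hr : ∑ j, c i * (star (c j) * c j) = c 0 * c 0 * c i := by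
    simp [← mul_assoc, h.2.1, pow_two, ite_mul]
  rw [commute_iff_eq, h.star_mul_self_s, sub_mul, mul_sub, Finset.sum_mul, Finset.mul_sum, hl, hr,
    one_mul, mul_one]

lemma star_mul_self_mul_s (h : SatisfiesRk c s) : star s * s * s = 0 := by
  rw [h.star_mul_self_s, sub_mul, Finset.sum_mul, Finset.sum_eq_single 0]
  · simp [h.star_zero, mul_assoc, h.2.2.2]
  · intro j _ hj
    rw [mul_assoc, h.mul_s_of_ne hj, mul_zero]
  · simp

lemma s_mul_star_mul_s (h : SatisfiesRk c s) (j : Fin k) : s * star (c j) * s = 0 := by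
  have hc : Commute (star s * s) (star (c j)) := by
    simpa using (h.commute_star_mul_self j).star_star
  rw [← CStarRing.star_mul_self_eq_zero_iff]
  calc star (s * star (c j) * s) * (s * star (c j) * s)
      = star s * c j * (star s * s * star (c j)) * s := by simp only [star_mul, star_star, mul_assoc]
    _ = star s * c j * star (c j) * (star s * s * s) := by rw [hc.eq]; simp only [mul_assoc]
    _ = 0 := by rw [h.star_mul_self_mul_s, mul_zero]

lemma commute_generator (h : SatisfiesRk c s) (i : Fin k) :
    Commute ((∑ j, star (c j) * s * star s * c j) + star s * s) (c i) := by
  have hl : ∑ j, star (c j) * s * star s * c j * c i = s * star s * c i := by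
    rw [Finset.sum_eq_single 0]
    · rw [h.star_zero, h.2.2.2, mul_assoc s, h.star_s_mul]
    · intro j _ hj
      rw [mul_assoc, h.mul_eq_zero_of_ne hj, mul_zero]
    · simp
  have hr : ∑ j, c i * (star (c j) * s * star s * c j) = s * star s * c i := by
    simp [← mul_assoc, h.2.1, pow_two, ite_mul, mul_assoc _ _ s, h.2.2.2]
  rw [commute_iff_eq, add_mul, mul_add, Finset.sum_mul, Finset.mul_sum, hl, hr,
    (h.commute_star_mul_self i).eq]

lemma commute_s (h : SatisfiesRk c s) :
    Commute ((∑ j, star (c j) * s * star s * c j) + star s * s) s := by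
  have hl : ∑ j, star (c j) * s * star s * c j * s = s * star s * s := by
    rw [Finset.sum_eq_single 0]
    · rw [h.star_zero, h.2.2.2, mul_assoc s, h.star_s_mul]
    · intro j _ hj
      rw [mul_assoc, h.mul_s_of_ne hj, mul_zero]
    · simp
  have hr : ∑ j, s * (star (c j) * s * star s * c j) = 0 := by
    simp [← mul_assoc, h.s_mul_star_mul_s]
  rw [commute_iff_eq, add_mul, mul_add, Finset.sum_mul, Finset.mul_sum, hl, hr,
    h.star_mul_self_mul_s, add_zero, zero_add, mul_assoc]

end SatisfiesRk

theorem stmt4 {A : Type*} [CStarAlgebra A] [PartialOrder A] [StarOrderedRing A]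
    (k : ℕ) [NeZero k] (hk : 1 ≤ k) (c : Fin k → A) (s : A)
    (hRk : SatisfiesRk c s) :
    (∀ j : Fin k, Commute ((∑ j : Fin k, star (c j) * s * star s * c j) + star s * s) (c j)) ∧
    Commute ((∑ j : Fin k, star (c j) * s * star s * c j) + star s * s) s ∧
    (∑ j : Fin k, star (c j) * s * star s * c j) + star s * s ∈
      closure ((StarAlgebra.adjoin ℂ (Set.range c ∪ {s}) : StarSubalgebra ℂ A) : Set A) ∧
    ∀ x ∈ closure ((StarAlgebra.adjoin ℂ (Set.range c ∪ {s}) : StarSubalgebra ℂ A) : Set A),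
      Commute ((∑ j : Fin k, star (c j) * s * star s * c j) + star s * s) x := by
  set b := (∑ j : Fin k, star (c j) * s * star s * c j) + star s * s with hb
  have hbc : ∀ j, Commute b (c j) := hRk.commute_generator
  have hbs : Commute b s := hRk.commute_s
  have hstar : star b = b := by simp [hb, star_sum, mul_assoc]
  refine ⟨hbc, hbs, subset_closure ?_, ?_⟩
  · have hc (j : Fin k) : c j ∈ StarAlgebra.adjoin ℂ (Set.range c ∪ {s}) :=
      StarAlgebra.subset_adjoin ℂ _ (Or.inl ⟨j, rfl⟩)
    have hs : s ∈ StarAlgebra.adjoin ℂ (Set.range c ∪ {s}) :=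
      StarAlgebra.subset_adjoin ℂ _ (Or.inr rfl)
    exact add_mem (sum_mem fun j _ ↦
      mul_mem (mul_mem (mul_mem (star_mem (hc j)) hs) (star_mem hs)) (hc j))
      (mul_mem (star_mem hs) hs)
  · have hle : StarAlgebra.adjoin ℂ (Set.range c ∪ {s}) ≤ StarSubalgebra.centralizer ℂ {b} := by
      refine StarAlgebra.adjoin_le fun x hx ↦ StarSubalgebra.mem_centralizer_iff ℂ |>.2 ?_
      rintro _ rfl
      rw [hstar, and_self]
      rcases hx with ⟨j, rfl⟩ | rfl
      exacts [(hbc j).eq, hbs.eq]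
    intro x hx
    have hx' : x ∈ StarSubalgebra.centralizer ℂ {b} :=
      closure_minimal hle (Set.isClosed_centralizer _) hx
    exact ((StarSubalgebra.mem_centralizer_iff ℂ).1 hx' b rfl).1
end

section
/- Let k ≥ 1, let A be a unital C*-algebra, and let c_1, …, c_k, s ∈ A satisfy the relations R_k. If moreover Σ_{j=1}^k c_j* s s* c_j + s* s = 1, then c_1² = s s*, and the k+1 elements c_1* c_1, c_2* c_2, …, c_k* c_k, s* s are mutually orthogonal projections whose sum is 1. -/
/- Statement 5: if c_1, …, c_k, s satisfy R_k and Σ_j c_j* s s* c_j + s* s = 1,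
   then c_1² = s s* and c_1* c_1, …, c_k* c_k, s* s are mutually orthogonal
   projections summing to 1. -/

open scoped ComplexOrder

/-- If `star s * s ≤ 1` then also `s * star s ≤ 1`. -/
theorem mul_star_self_le_one_of_star_mul_self_le_one {A : Type*} [CStarAlgebra A]
    [PartialOrder A] [StarOrderedRing A] {s : A} (h : star s * s ≤ 1) : s * star s ≤ 1 := by
  rw [← CStarAlgebra.norm_le_one_iff_of_nonneg _ (mul_star_self_nonneg s),
    CStarRing.norm_self_mul_star, ← CStarRing.norm_star_mul_self,
    CStarAlgebra.norm_le_one_iff_of_nonneg _ (star_mul_self_nonneg s)]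
  exact h

theorem stmt5 {A : Type*} [CStarAlgebra A] [PartialOrder A] [StarOrderedRing A]
    (k : ℕ) [NeZero k] (hk : 1 ≤ k) (c : Fin k → A) (s : A)
    (hRk : SatisfiesRk c s)
    (hβ : (∑ j : Fin k, star (c j) * s * star s * c j) + star s * s = 1) :
    -- the k+1 elements c_1* c_1, …, c_k* c_k, s* s
    letI P : Fin (k + 1) → A := Fin.snoc (fun j => star (c j) * c j) (star s * s)
    c 0 ^ 2 = s * star s ∧
    (∀ i, IsSelfAdjoint (P i) ∧ P i * P i = P i) ∧
    (∀ i j, i ≠ j → P i * P j = 0) ∧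
    ∑ i, P i = 1 := by
  obtain ⟨hpos, hmul, hsum, hs⟩ := hRk
  have hsa : star (c 0) = c 0 := (IsSelfAdjoint.of_nonneg hpos).star_eq
  have hle : s * star s ≤ 1 := by
    refine mul_star_self_le_one_of_star_mul_self_le_one ?_
    rw [← hsum]
    exact le_add_of_nonneg_left (Finset.sum_nonneg fun j _ => star_mul_self_nonneg _)
  have hdefect : ∀ j, star (c j) * s * star s * c j = star (c j) * c j := by
    have hnonneg : ∀ j ∈ Finset.univ, 0 ≤ star (c j) * (1 - s * star s) * c j := fun j _ =>
      star_left_conjugate_nonneg (sub_nonneg.mpr hle) _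
    have hzero : ∑ j, star (c j) * (1 - s * star s) * c j = 0 := by
      simp only [mul_sub, sub_mul, mul_one, Finset.sum_sub_distrib, ← mul_assoc]
      exact sub_eq_zero.mpr (add_right_cancel (hsum.trans hβ.symm))
    intro j
    have hj := (Finset.sum_eq_zero_iff_of_nonneg hnonneg).mp hzero j (Finset.mem_univ j)
    simp only [mul_sub, sub_mul, mul_one, ← mul_assoc] at hj
    exact (sub_eq_zero.mp hj).symm
  have hrange : c 0 ^ 2 = s * star s := by
    have hs' : star s * c 0 = star s := by
      simpa [hsa] using congrArg star hs
    have h := hdefect 0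
    rw [hsa, hs, mul_assoc, hs'] at h
    rw [sq, h]
  have hidem : ∀ j, star (c j) * c j * (star (c j) * c j) = star (c j) * c j := by
    intro j
    rw [mul_assoc, ← mul_assoc (c j), hmul, if_pos rfl, hrange, ← mul_assoc, ← mul_assoc,
      hdefect]
  have horth : ∀ i j, i ≠ j → star (c i) * c i * (star (c j) * c j) = 0 := by
    intro i j hij
    rw [mul_assoc, ← mul_assoc (c i), hmul, if_neg hij, zero_mul, mul_zero]
  have hs_eq : star s * s = 1 - ∑ j, star (c j) * c j := eq_sub_of_add_eq' hsum
  have hleft : ∀ i, star (c i) * c i * (star s * s) = 0 := by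
    intro i
    rw [hs_eq, mul_sub, mul_one, Finset.mul_sum,
      Finset.sum_eq_single i (fun j _ hj => horth i j hj.symm) (by simp), hidem, sub_self]
  have hright : ∀ i, star s * s * (star (c i) * c i) = 0 := by
    intro i
    simpa [mul_assoc] using congrArg star (hleft i)
  have hs_idem : star s * s * (star s * s) = star s * s := by
    conv_lhs => enter [1]; rw [hs_eq]
    rw [sub_mul, one_mul, Finset.sum_mul, Finset.sum_eq_zero fun i _ => hleft i, sub_zero]
  refine ⟨hrange, fun i => ?_, fun i j hij => ?_, ?_⟩
  · induction i using Fin.lastCases with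
    | last => simpa using hs_idem
    | cast i => simpa using hidem i
  · induction i using Fin.lastCases with
    | last =>
      induction j using Fin.lastCases with
      | last => exact absurd rfl hij
      | cast j => simpa using hright j
    | cast i =>
      induction j using Fin.lastCases with
      | last => simpa using hleft i
      | cast j => simpa using horth i j (fun h => hij (congrArg _ h))
  · simpa [Fin.sum_univ_castSucc] using hsum
end

section
/- Let A be a unital C*-algebra, let (f_n) be a sequence of positive contractions in A, and let (m_n) be an increasing sequence of natural numbers with m_n → ∞. Then there exists a sequence (f̃_n) of positive contractions in A with ‖f̃_n − f_n‖ → 0 and liminf_{n→∞} inf_{τ ∈ T(A)} d̄_τ(f̃_n) ≥ liminf_{n→∞} inf_{τ ∈ T(A)} τ(f_n^{m_n}). -/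
/- Statement 12: for positive contractions (f_n) and m_n ↗ ∞ there are positive
   contractions f̃_n with ‖f̃_n − f_n‖ → 0 and
   liminf_n inf_{τ ∈ T(A)} d̄_τ(f̃_n) ≥ liminf_n inf_{τ ∈ T(A)} τ(f_n^{m_n}). -/

open scoped ComplexOrder
open Filter

/-- A tracial state on a unital C*-algebra. -/
def IsTracialState {A : Type*} [CStarAlgebra A] (τ : A →L[ℂ] ℂ) : Prop :=
  τ 1 = 1 ∧ (∀ a : A, 0 ≤ τ (star a * a)) ∧ ∀ a b : A, τ (a * b) = τ (b * a)

/-- `d̄_τ(f) = lim_n τ(f^n)`. -/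
noncomputable def dimBar {A : Type*} [CStarAlgebra A] (τ : A →L[ℂ] ℂ) (f : A) : ℝ :=
  limUnder atTop fun n : ℕ => (τ (f ^ n)).re

section CutOff

variable {A : Type*} [CStarAlgebra A]

lemma IsTracialState.mono [PartialOrder A] [StarOrderedRing A] {τ : A →L[ℂ] ℂ}
    (hτ : IsTracialState τ) {a b : A} (hab : a ≤ b) : (τ a).re ≤ (τ b).re := by
  obtain ⟨c, hc⟩ := CStarAlgebra.nonneg_iff_eq_star_mul_self.mp (sub_nonneg.mpr hab)
  have h := hτ.2.1 c
  rw [← hc, map_sub] at h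
  have := (Complex.le_def.mp h).1
  simp only [Complex.zero_re, Complex.sub_re] at this
  linarith

lemma IsTracialState.map_algebraMap {τ : A →L[ℂ] ℂ} (hτ : IsTracialState τ) (r : ℝ) :
    (τ (algebraMap ℝ A r)).re = r := by
  have h : algebraMap ℝ A r = (r : ℂ) • (1 : A) := by
    rw [Algebra.algebraMap_eq_smul_one]; simp
  rw [h, map_smul, hτ.1]
  simp

lemma spectrum_subset_Icc [PartialOrder A] [StarOrderedRing A] {a : A} (ha : 0 ≤ a)
    (ha' : ‖a‖ ≤ 1) {t : ℝ} (ht : t ∈ spectrum ℝ a) : 0 ≤ t ∧ t ≤ 1 := by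
  refine ⟨spectrum_nonneg_of_nonneg ha ht, ?_⟩
  have h : a ≤ algebraMap ℝ A 1 := by
    simpa using (CStarAlgebra.norm_le_one_iff_of_nonneg a ha).mp ha'
  exact (le_algebraMap_iff_spectrum_le (.of_nonneg ha)).mp h t ht

lemma IsTracialState.map_pow_nonneg [PartialOrder A] [StarOrderedRing A] {τ : A →L[ℂ] ℂ}
    (hτ : IsTracialState τ) {g : A} (hg : 0 ≤ g) (k : ℕ) : 0 ≤ (τ (g ^ k)).re := by
  simpa using hτ.mono (CStarAlgebra.pow_nonneg hg k)

lemma IsTracialState.antitone_map_pow [PartialOrder A] [StarOrderedRing A] {τ : A →L[ℂ] ℂ}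
    (hτ : IsTracialState τ) {g : A} (hg : 0 ≤ g) (hg' : ‖g‖ ≤ 1) :
    Antitone fun k : ℕ => (τ (g ^ k)).re := fun _ _ hij =>
  hτ.mono (CStarAlgebra.pow_antitone hg
    ((CStarAlgebra.norm_le_one_iff_of_nonneg g hg).mp hg') hij)

/-- `d̄_τ(g)` is the limit of the decreasing sequence `τ(g ^ k)`, hence at least any lower bound
of this sequence. -/
lemma IsTracialState.le_dimBar [PartialOrder A] [StarOrderedRing A] {τ : A →L[ℂ] ℂ}
    (hτ : IsTracialState τ) {g : A} (hg : 0 ≤ g) (hg' : ‖g‖ ≤ 1) {c : ℝ}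
    (hc : ∀ k : ℕ, c ≤ (τ (g ^ k)).re) : c ≤ dimBar τ g := by
  have hanti := hτ.antitone_map_pow hg hg'
  have hlim := tendsto_atTop_ciInf hanti ⟨c, by rintro _ ⟨k, rfl⟩; exact hc k⟩
  rw [dimBar, hlim.limUnder_eq]
  exact le_ciInf hc

lemma IsTracialState.dimBar_le_one [PartialOrder A] [StarOrderedRing A] {τ : A →L[ℂ] ℂ}
    (hτ : IsTracialState τ) {g : A} (hg : 0 ≤ g) (hg' : ‖g‖ ≤ 1) : dimBar τ g ≤ 1 := by
  have hanti := hτ.antitone_map_pow hg hg'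
  have hbdd : BddBelow (Set.range fun k : ℕ => (τ (g ^ k)).re) :=
    ⟨0, by rintro _ ⟨k, rfl⟩; exact hτ.map_pow_nonneg hg k⟩
  rw [dimBar, (tendsto_atTop_ciInf hanti hbdd).limUnder_eq]
  exact (ciInf_le hbdd 0).trans (by simp [hτ.1])

/-- The functional calculus of `t ↦ min 1 (t + δ)`. -/
noncomputable def raise (δ : ℝ) (a : A) : A := cfc (fun t : ℝ => min 1 (t + δ)) a

section

variable [PartialOrder A] [StarOrderedRing A] {a : A} {δ : ℝ}

lemma raise_nonneg (ha : 0 ≤ a) (ha' : ‖a‖ ≤ 1) (hδ : 0 ≤ δ) : 0 ≤ raise δ a :=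
  cfc_nonneg fun _ ht => le_min zero_le_one (add_nonneg (spectrum_subset_Icc ha ha' ht).1 hδ)

lemma norm_raise_le (ha : 0 ≤ a) (ha' : ‖a‖ ≤ 1) (hδ : 0 ≤ δ) : ‖raise δ a‖ ≤ 1 := by
  refine norm_cfc_le zero_le_one fun t ht => ?_
  rw [Real.norm_of_nonneg
    (le_min zero_le_one (add_nonneg (spectrum_subset_Icc ha ha' ht).1 hδ))]
  exact min_le_left _ _

lemma norm_raise_sub_le (ha : 0 ≤ a) (ha' : ‖a‖ ≤ 1) (hδ : 0 ≤ δ) : ‖raise δ a - a‖ ≤ δ := by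
  have hsa : IsSelfAdjoint a := .of_nonneg ha
  have h : raise δ a - a = cfc (fun t : ℝ => min 1 (t + δ) - t) a := by
    rw [cfc_sub (fun t : ℝ => min 1 (t + δ)) (fun t => t) a, cfc_id' ℝ a, raise]
  rw [h]
  refine norm_cfc_le hδ fun t ht => ?_
  obtain ⟨-, h1⟩ := spectrum_subset_Icc ha ha' ht
  rw [Real.norm_eq_abs, abs_le]
  constructor
  · linarith [le_min h1 (le_add_of_nonneg_right hδ : t ≤ t + δ)]
  · linarith [min_le_right 1 (t + δ)]

lemma pow_le_raise_pow_add (ha : 0 ≤ a) (ha' : ‖a‖ ≤ 1) (hδ : 0 ≤ δ) (hδ' : δ ≤ 1) (m k : ℕ) :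
    a ^ m ≤ raise δ a ^ k + algebraMap ℝ A ((1 - δ) ^ m) := by
  have hsa : IsSelfAdjoint a := .of_nonneg ha
  have h : raise δ a ^ k + algebraMap ℝ A ((1 - δ) ^ m) =
      cfc (fun t : ℝ => min 1 (t + δ) ^ k + (1 - δ) ^ m) a := by
    rw [cfc_add_const ((1 - δ) ^ m) (fun t : ℝ => min 1 (t + δ) ^ k) a,
      cfc_pow (fun t : ℝ => min 1 (t + δ)) k a, raise]
  rw [h, ← cfc_pow_id (R := ℝ) a m]
  refine cfc_mono fun t ht => ?_
  obtain ⟨h0, h1⟩ := spectrum_subset_Icc ha ha' ht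
  rcases le_total (1 - δ) t with hle | hle
  · rw [min_eq_left (by linarith), one_pow]
    linarith [pow_le_one₀ h0 h1 (n := m), pow_nonneg (sub_nonneg.mpr hδ') m]
  · have : 0 ≤ min 1 (t + δ) ^ k := pow_nonneg (le_min zero_le_one (add_nonneg h0 hδ)) k
    linarith [pow_le_pow_left₀ h0 hle m]

lemma IsTracialState.map_pow_le_dimBar_raise {τ : A →L[ℂ] ℂ} (hτ : IsTracialState τ)
    (ha : 0 ≤ a) (ha' : ‖a‖ ≤ 1) (hδ : 0 ≤ δ) (hδ' : δ ≤ 1) (m : ℕ) :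
    (τ (a ^ m)).re ≤ dimBar τ (raise δ a) + (1 - δ) ^ m := by
  rw [← sub_le_iff_le_add]
  refine hτ.le_dimBar (raise_nonneg ha ha' hδ) (norm_raise_le ha ha' hδ) fun k => ?_
  have h := hτ.mono (pow_le_raise_pow_add ha ha' hδ hδ' m k)
  rw [map_add, Complex.add_re, hτ.map_algebraMap] at h
  linarith

end

end CutOff

/-- Passing from a family `F τ` to a family `G τ` with `F τ ≤ G τ + ε` moves the infimum by at
most `ε`. -/
lemma sInf_le_sInf_add {ι : Type*} {P : ι → Prop} {F G : ι → ℝ} {ε : ℝ} (hε : 0 ≤ ε)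
    (hF : ∀ i, P i → 0 ≤ F i) (h : ∀ i, P i → F i ≤ G i + ε) :
    sInf {x | ∃ i, P i ∧ x = F i} ≤ sInf {x | ∃ i, P i ∧ x = G i} + ε := by
  by_cases hP : ∃ i, P i
  · obtain ⟨i₀, hi₀⟩ := hP
    rw [← sub_le_iff_le_add]
    refine le_csInf ⟨_, i₀, hi₀, rfl⟩ ?_
    rintro _ ⟨i, hi, rfl⟩
    rw [sub_le_iff_le_add]
    have hbdd : BddBelow {x | ∃ i, P i ∧ x = F i} :=
      ⟨0, by rintro _ ⟨j, hj, rfl⟩; exact hF j hj⟩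
    exact (csInf_le hbdd ⟨i, hi, rfl⟩).trans (h i hi)
  · push Not at hP
    simp [hP, hε]

lemma sInf_mem_Icc {ι : Type*} {P : ι → Prop} {F : ι → ℝ}
    (h : ∀ i, P i → 0 ≤ F i ∧ F i ≤ 1) : sInf {x | ∃ i, P i ∧ x = F i} ∈ Set.Icc (0 : ℝ) 1 := by
  have h0 : ∀ x ∈ {x | ∃ i, P i ∧ x = F i}, 0 ≤ x := by
    rintro _ ⟨j, hj, rfl⟩; exact (h j hj).1
  refine ⟨Real.sInf_nonneg h0, ?_⟩
  by_cases hP : ∃ i, P i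
  · obtain ⟨i, hi⟩ := hP
    exact (csInf_le ⟨0, h0⟩ ⟨i, hi, rfl⟩).trans (h i hi).2
  · push Not at hP
    simp [hP]

lemma liminf_le_liminf_of_le_add_tendsto_zero {u v ε : ℕ → ℝ} (hu : ∀ n, u n ∈ Set.Icc (0 : ℝ) 1)
    (hv : ∀ n, v n ∈ Set.Icc (0 : ℝ) 1) (h : ∀ n, u n ≤ v n + ε n)
    (hε : Tendsto ε atTop (nhds 0)) : liminf u atTop ≤ liminf v atTop := by
  have hbu : IsBoundedUnder (· ≥ ·) atTop u := isBoundedUnder_of ⟨0, fun n => (hu n).1⟩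
  have hbv : IsBoundedUnder (· ≥ ·) atTop v := isBoundedUnder_of ⟨0, fun n => (hv n).1⟩
  have hcv : IsCoboundedUnder (· ≥ ·) atTop v :=
    (isBoundedUnder_of ⟨1, fun n => (hv n).2⟩ : IsBoundedUnder (· ≤ ·) atTop v).isCoboundedUnder_ge
  refine le_of_forall_pos_le_add fun c hc => ?_
  rw [← liminf_add_const atTop v c hcv hbv]
  refine liminf_le_liminf ?_ hbu ?_
  · filter_upwards [hε.eventually (gt_mem_nhds hc)] with n hn
    linarith [h n]
  · exact (isBoundedUnder_of ⟨1 + c, fun n => by linarith [(hv n).2]⟩ :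
      IsBoundedUnder (· ≤ ·) atTop fun n => v n + c).isCoboundedUnder_ge

lemma tendsto_inv_sqrt_succ :
    Tendsto (fun m : ℕ => (√((m : ℝ) + 1))⁻¹) atTop (nhds 0) :=
  (Real.tendsto_sqrt_atTop.comp
    (tendsto_atTop_add_const_right _ 1 tendsto_natCast_atTop_atTop)).inv_tendsto_atTop

lemma inv_sqrt_succ_le_one (m : ℕ) : (√((m : ℝ) + 1))⁻¹ ≤ 1 :=
  inv_le_one_of_one_le₀ (Real.one_le_sqrt.mpr (by simp))

lemma tendsto_one_sub_inv_sqrt_succ_pow :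
    Tendsto (fun m : ℕ => (1 - (√((m : ℝ) + 1))⁻¹) ^ m) atTop (nhds 0) := by
  have hlim : Tendsto (fun m : ℕ => Real.exp (1 - √((m : ℝ) + 1))) atTop (nhds 0) :=
    Real.tendsto_exp_atBot.comp (tendsto_atBot_add_const_left _ 1 (tendsto_neg_atTop_atBot.comp
      (Real.tendsto_sqrt_atTop.comp
        (tendsto_atTop_add_const_right _ 1 tendsto_natCast_atTop_atTop))))
  refine squeeze_zero (fun m => pow_nonneg (sub_nonneg.mpr (inv_sqrt_succ_le_one m)) m)
    (fun m => ?_) hlim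
  have hle := inv_sqrt_succ_le_one m
  calc (1 - (√((m : ℝ) + 1))⁻¹) ^ m ≤ Real.exp (-(√((m : ℝ) + 1))⁻¹) ^ m :=
        pow_le_pow_left₀ (sub_nonneg.mpr hle) (Real.one_sub_le_exp_neg _) m
    _ = Real.exp (m * -(√((m : ℝ) + 1))⁻¹) := (Real.exp_nat_mul _ m).symm
    _ ≤ Real.exp (1 - √((m : ℝ) + 1)) := by
        refine Real.exp_le_exp.mpr ?_
        have hs : 0 < √((m : ℝ) + 1) := Real.sqrt_pos.mpr (by positivity)
        have hsq : √((m : ℝ) + 1) * √((m : ℝ) + 1) = m + 1 := Real.mul_self_sqrt (by positivity)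
        have hm : (m : ℝ) * (√((m : ℝ) + 1))⁻¹ = √((m : ℝ) + 1) - (√((m : ℝ) + 1))⁻¹ := by
          field_simp
          linarith
        linarith

theorem stmt12 {A : Type*} [CStarAlgebra A] [PartialOrder A] [StarOrderedRing A]
    (f : ℕ → A) (hpos : ∀ n, 0 ≤ f n) (hcontr : ∀ n, ‖f n‖ ≤ 1)
    (m : ℕ → ℕ) (hm : Monotone m) (hm' : Tendsto m atTop atTop) :
    ∃ g : ℕ → A, (∀ n, 0 ≤ g n) ∧ (∀ n, ‖g n‖ ≤ 1) ∧
      Tendsto (fun n => ‖g n - f n‖) atTop (nhds 0) ∧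
      liminf
          (fun n => sInf {x : ℝ | ∃ τ : A →L[ℂ] ℂ, IsTracialState τ ∧ x = (τ (f n ^ m n)).re})
          atTop ≤
        liminf
          (fun n => sInf {x : ℝ | ∃ τ : A →L[ℂ] ℂ, IsTracialState τ ∧ x = dimBar τ (g n)})
          atTop := by
  set δ : ℕ → ℝ := fun n => (√((m n : ℝ) + 1))⁻¹
  have hδ : ∀ n, 0 ≤ δ n := fun n => inv_nonneg.mpr (Real.sqrt_nonneg _)
  have hδ' : ∀ n, δ n ≤ 1 := fun n => inv_sqrt_succ_le_one (m n)
  have hgpos n : 0 ≤ raise (δ n) (f n) := raise_nonneg (hpos n) (hcontr n) (hδ n)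
  have hgcontr n : ‖raise (δ n) (f n)‖ ≤ 1 := norm_raise_le (hpos n) (hcontr n) (hδ n)
  have hfpow n (τ : A →L[ℂ] ℂ) (hτ : IsTracialState τ) :
      0 ≤ (τ (f n ^ m n)).re ∧ (τ (f n ^ m n)).re ≤ 1 :=
    ⟨hτ.map_pow_nonneg (hpos n) (m n), by
      simpa [hτ.1] using hτ.antitone_map_pow (hpos n) (hcontr n) (Nat.zero_le (m n))⟩
  refine ⟨fun n => raise (δ n) (f n), hgpos, hgcontr, ?_, ?_⟩
  · exact squeeze_zero (fun n => norm_nonneg _)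
      (fun n => norm_raise_sub_le (hpos n) (hcontr n) (hδ n)) (tendsto_inv_sqrt_succ.comp hm')
  · refine liminf_le_liminf_of_le_add_tendsto_zero (fun n => sInf_mem_Icc (hfpow n))
      (fun n => sInf_mem_Icc fun τ hτ => ⟨?_, hτ.dimBar_le_one (hgpos n) (hgcontr n)⟩)
      (fun n => sInf_le_sInf_add (pow_nonneg (sub_nonneg.mpr (hδ' n)) (m n))
        (fun τ hτ => (hfpow n τ hτ).1) fun τ hτ =>
          hτ.map_pow_le_dimBar_raise (hpos n) (hcontr n) (hδ n) (hδ' n) (m n))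
      (tendsto_one_sub_inv_sqrt_succ_pow.comp hm')
    exact hτ.le_dimBar (hgpos n) (hgcontr n) (hτ.map_pow_nonneg (hgpos n))
end

section
/- Let N ≥ 1 and let e, f be positive semidefinite N×N complex matrices with e ≤ 1 and f ≤ 1 (i.e., both are positive contractions). If rank(e) ≤ dim ker(1 − f) (the dimension of the eigenspace of f for the eigenvalue 1), then there exists an N×N complex matrix s such that s* s = e and f s = s. -/
/- Statement 13: if e, f are positive contractions in M_N(ℂ) and
   rank(e) ≤ dim ker(1 − f), then there is a matrix s with s* s = e and f s = s. -/

open scoped ComplexOrder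
open Matrix

/-- A predicate holding no more often than another one can be permuted into it. -/
theorem exists_perm_imp_of_card_le {ι : Type*} [Fintype ι] (p q : ι → Prop)
    [DecidablePred p] [DecidablePred q]
    (h : Fintype.card {i // p i} ≤ Fintype.card {i // q i}) :
    ∃ π : Equiv.Perm ι, ∀ i, p i → q (π i) := by
  classical
  obtain ⟨φ⟩ := Function.Embedding.nonempty_of_card_le h
  let ψ : {i // p i} → ι := fun i => φ i
  have hψ : Function.Injective ψ := Subtype.val_injective.comp φ.injective
  let E : {i // p i} ≃ {i // i ∈ Set.range ψ} := Equiv.ofInjective ψ hψ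
  refine ⟨E.extendSubtype, fun i hi => ?_⟩
  rw [Equiv.extendSubtype_apply_of_mem E i hi]
  exact (φ ⟨i, hi⟩).2

/-- The kernel of a Hermitian matrix has dimension the number of its zero eigenvalues. -/
theorem Matrix.IsHermitian.finrank_ker_eq_card_zero_eigs {n : Type*} [Fintype n] [DecidableEq n]
    {h : Matrix n n ℂ} (hh : h.IsHermitian) :
    Module.finrank ℂ (LinearMap.ker (Matrix.toLin' h)) =
      Fintype.card {i // hh.eigenvalues i = 0} := by
  have h1 := LinearMap.finrank_range_add_finrank_ker (Matrix.toLin' h)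
  have h2 : Module.finrank ℂ (LinearMap.range (Matrix.toLin' h)) = h.rank := rfl
  have h3 := Fintype.card_subtype_compl (fun i => hh.eigenvalues i = 0)
  have h4 := Fintype.card_subtype_le (fun i => hh.eigenvalues i = 0)
  have h5 : h.rank = Fintype.card {i // ¬ hh.eigenvalues i = 0} := hh.rank_eq_card_non_zero_eigs
  rw [Module.finrank_fintype_fun_eq_card] at h1
  omega

/-- A positive semidefinite `e` whose rank is at most the nullity of a Hermitian `h` factors as
`sᴴ * s` with the range of `s` inside the kernel of `h`. -/
theorem Matrix.PosSemidef.exists_conjTranspose_mul_self_eq_and_mul_eq_zero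
    {n : Type*} [Fintype n] [DecidableEq n] {e h : Matrix n n ℂ}
    (he : e.PosSemidef) (hh : h.IsHermitian)
    (hrank : e.rank ≤ Module.finrank ℂ (LinearMap.ker (Matrix.toLin' h))) :
    ∃ s : Matrix n n ℂ, sᴴ * s = e ∧ h * s = 0 := by
  rw [hh.finrank_ker_eq_card_zero_eigs, he.1.rank_eq_card_non_zero_eigs] at hrank
  obtain ⟨π, hπ⟩ := exists_perm_imp_of_card_le _ _ hrank
  let U : Matrix n n ℂ := he.1.eigenvectorUnitary
  let V : Matrix n n ℂ := hh.eigenvectorUnitary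
  have hV : Vᴴ * V = 1 := Unitary.coe_star_mul_self hh.eigenvectorUnitary
  have hes : e = U * diagonal (fun i => (he.1.eigenvalues i : ℂ)) * Uᴴ :=
    he.1.spectral_theorem
  have hhs : h = V * diagonal (fun i => (hh.eigenvalues i : ℂ)) * Vᴴ :=
    hh.spectral_theorem
  let W : Matrix n n ℂ := of fun j i => if j = π i then (√(he.1.eigenvalues i) : ℂ) else 0
  have hWW : Wᴴ * W = diagonal (fun i => (he.1.eigenvalues i : ℂ)) := by
    ext i k
    by_cases hik : i = k
    · subst hik
      simp [W, mul_apply, ← Complex.ofReal_mul, Real.mul_self_sqrt (he.eigenvalues_nonneg i)]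
    · simp [W, mul_apply, hik, Ne.symm hik]
  have hDW : diagonal (fun i => (hh.eigenvalues i : ℂ)) * W = 0 := by
    ext j i
    by_cases hi : he.1.eigenvalues i = 0
    · simp [W, hi]
    · by_cases hj : j = π i
      · simp [hj, hπ i hi]
      · simp [W, hj]
  refine ⟨V * W * Uᴴ, ?_, ?_⟩
  · calc (V * W * Uᴴ)ᴴ * (V * W * Uᴴ) = U * (Wᴴ * (Vᴴ * V) * W) * Uᴴ := by
          simp only [conjTranspose_mul, conjTranspose_conjTranspose, Matrix.mul_assoc]
      _ = e := by rw [hV, Matrix.mul_one, hWW, ← hes]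
  · calc h * (V * W * Uᴴ)
        = V * (diagonal (fun i => (hh.eigenvalues i : ℂ)) * ((Vᴴ * V) * W)) * Uᴴ := by
          conv_lhs => rw [hhs]
          simp only [Matrix.mul_assoc]
      _ = 0 := by rw [hV, Matrix.one_mul, hDW, Matrix.mul_zero, Matrix.zero_mul]

theorem stmt13 (N : ℕ) (hN : 1 ≤ N) (e f : Matrix (Fin N) (Fin N) ℂ)
    (he : e.PosSemidef) (hf : f.PosSemidef)
    (he1 : ((1 : Matrix (Fin N) (Fin N) ℂ) - e).PosSemidef)
    (hf1 : ((1 : Matrix (Fin N) (Fin N) ℂ) - f).PosSemidef)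
    (hrank : e.rank ≤
      Module.finrank ℂ
        (LinearMap.ker (Matrix.toLin' ((1 : Matrix (Fin N) (Fin N) ℂ) - f)))) :
    ∃ s : Matrix (Fin N) (Fin N) ℂ, sᴴ * s = e ∧ f * s = s := by
  obtain ⟨s, hs, hs0⟩ := he.exists_conjTranspose_mul_self_eq_and_mul_eq_zero hf1.1 hrank
  rw [Matrix.sub_mul, Matrix.one_mul, sub_eq_zero] at hs0
  exact ⟨s, hs, hs0.symm⟩
end

section
/- Let A be a unital C*-algebra which has a unique tracial state τ. If u_1, u_2 are unitaries in A with ‖u_1 − 1‖ < 1/2 and ‖u_2 − 1‖ < 1/2, then τ(log(u_1 u_2)) = τ(log u_1) + τ(log u_2). (Note that ‖u_1 u_2 − 1‖ ≤ ‖u_1 − 1‖ + ‖u_2 − 1‖ < 1, so all three logarithms are defined.) -/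
/- Statement 14: in a unital C*-algebra with a unique tracial state τ, if
   ‖u₁ − 1‖ < 1/2 and ‖u₂ − 1‖ < 1/2 for unitaries u₁, u₂, then
   τ(log(u₁u₂)) = τ(log u₁) + τ(log u₂). -/

open scoped ComplexOrder

open Filter Topology

/-- The Mercator series `x - x ^ 2 / 2 + x ^ 3 / 3 - ⋯` of `log (1 + x)` in a Banach algebra. -/
noncomputable def mercatorSeries {A : Type*} [NormedRing A] [NormedAlgebra ℂ A] (x : A) : A :=
  ∑' n : ℕ, ((-1) ^ n / (n + 1) : ℂ) • x ^ (n + 1)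

lemma norm_mercator_coeff_le (n : ℕ) : ‖((-1) ^ n / (n + 1) : ℂ)‖ ≤ 1 := by
  have h : ‖((n : ℂ) + 1)‖ = n + 1 := by
    rw [← Nat.cast_add_one, Complex.norm_natCast, Nat.cast_add_one]
  rw [norm_div, norm_pow, norm_neg, norm_one, one_pow, h]
  exact div_le_one_of_le₀ (by linarith [n.cast_nonneg (α := ℝ)]) (by positivity)

lemma norm_mercator_term_le {A : Type*} [NormedRing A] [NormedAlgebra ℂ A] {x : A} {r : ℝ}
    (hx : ‖x‖ ≤ r) (n : ℕ) : ‖((-1) ^ n / (n + 1) : ℂ) • x ^ (n + 1)‖ ≤ r ^ (n + 1) :=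
  calc ‖((-1) ^ n / (n + 1) : ℂ) • x ^ (n + 1)‖ ≤ 1 * ‖x‖ ^ (n + 1) := by
        rw [norm_smul]
        exact mul_le_mul (norm_mercator_coeff_le n) (norm_pow_le' x n.succ_pos)
          (norm_nonneg _) zero_le_one
    _ ≤ r ^ (n + 1) := by
        rw [one_mul]
        exact pow_le_pow_left₀ (norm_nonneg _) hx _

lemma summable_pow_succ_of_lt_one {r : ℝ} (h₀ : 0 ≤ r) (h₁ : r < 1) :
    Summable fun n : ℕ ↦ r ^ (n + 1) :=
  (summable_nat_add_iff 1).2 (summable_geometric_of_lt_one h₀ h₁)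

lemma summable_mercatorSeries {A : Type*} [NormedRing A] [NormedAlgebra ℂ A] [CompleteSpace A]
    {x : A} (hx : ‖x‖ < 1) :
    Summable fun n : ℕ ↦ ((-1) ^ n / (n + 1) : ℂ) • x ^ (n + 1) :=
  .of_norm_bounded (summable_pow_succ_of_lt_one (norm_nonneg x) hx)
    (norm_mercator_term_le le_rfl)

lemma mercatorSeries_zero {A : Type*} [NormedRing A] [NormedAlgebra ℂ A] :
    mercatorSeries (0 : A) = 0 := by
  simp [mercatorSeries]

lemma Complex.mercatorSeries_eq_log {z : ℂ} (hz : ‖z‖ < 1) :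
    mercatorSeries z = Complex.log (1 + z) := by
  have h := (hasSum_nat_add_iff' 1).2 (Complex.hasSum_taylorSeries_log hz)
  simp only [Finset.sum_range_one, Nat.cast_zero, div_zero, sub_zero] at h
  rw [mercatorSeries, ← h.tsum_eq]
  refine tsum_congr fun n ↦ ?_
  simp only [smul_eq_mul, Nat.cast_add, Nat.cast_one, pow_succ]
  ring

lemma cfc_log_eq_mercatorSeries {A : Type*} [CStarAlgebra A] {u : A} (hu : IsStarNormal u)
    (h : ‖u - 1‖ < 1) : cfc Complex.log u = mercatorSeries (u - 1) := by
  rcases subsingleton_or_nontrivial A with _ | _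
  · exact Subsingleton.elim _ _
  have hspec : ∀ z ∈ spectrum ℂ u, ‖z - 1‖ ≤ ‖u - 1‖ := fun z hz ↦ by
    refine spectrum.norm_le_norm_of_mem ?_
    have := spectrum.sub_singleton_eq u (1 : ℂ)
    rw [map_one] at this
    exact this ▸ Set.sub_mem_sub hz rfl
  let P (N : ℕ) : Polynomial ℂ := ∑ n ∈ Finset.range N,
    Polynomial.C ((-1) ^ n / (n + 1) : ℂ) * (Polynomial.X - 1) ^ (n + 1)
  have hunif : TendstoUniformlyOn (fun N z ↦ (P N).eval z) Complex.log atTop (spectrum ℂ u) := by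
    refine ((tendstoUniformlyOn_tsum_nat
      (summable_pow_succ_of_lt_one (norm_nonneg (u - 1)) h)
      (fun n z hz ↦ norm_mercator_term_le (hspec z hz) n)).congr (.of_forall
        fun N z _ ↦ ?_)).congr_right fun z hz ↦ ?_
    · simp [P, Polynomial.eval_finsetSum]
    · have := Complex.mercatorSeries_eq_log ((hspec z hz).trans_lt h)
      rwa [add_sub_cancel] at this
  have hlim := tendsto_cfc_fun hunif (.of_forall fun N ↦ (P N).continuousOn)
  refine tendsto_nhds_unique hlim ?_
  refine (summable_mercatorSeries h).hasSum.tendsto_sum_nat.congr fun N ↦ ?_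
  rw [cfc_polynomial _ _ hu]
  simp [P, Algebra.smul_def]

section Derivative

variable {A : Type*} [NormedRing A] [NormedAlgebra ℂ A]

lemma hasDerivAt_trace_pow_succ {τ : A →L[ℂ] ℂ} (hτ : ∀ a b : A, τ (a * b) = τ (b * a))
    {z : ℂ → A} {w : A} {t : ℂ} (hz : HasDerivAt z w t) (n : ℕ) :
    HasDerivAt (fun s ↦ τ (z s ^ (n + 1))) ((n + 1) * τ (z t ^ n * w)) t := by
  have h := τ.hasFDerivAt.comp_hasDerivAt t (hz.fun_pow' (n + 1))
  convert! h using 1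
  rw [map_sum, Finset.sum_congr rfl (g := fun _ ↦ τ (z t ^ n * w))]
  · simp
  · intro i hi
    rw [hτ, ← mul_assoc, ← pow_add]
    congr 3
    have := Finset.mem_range.1 hi
    simp only [Nat.pred_succ]
    omega

/-- Under a bounded trace, `log (1 + z)` has derivative `(1 + z)⁻¹ * z'`. -/
lemma hasDerivAt_trace_mercatorSeries [CompleteSpace A] {τ : A →L[ℂ] ℂ}
    (hτ : ∀ a b : A, τ (a * b) = τ (b * a)) {x w v : A} {t : ℂ}
    (hlt : ‖x + t • w‖ < 1) (hv : v * (1 + (x + t • w)) = 1) :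
    HasDerivAt (fun s : ℂ ↦ τ (mercatorSeries (x + s • w))) (τ (v * w)) t := by
  obtain ⟨r, hr, hr₁⟩ := exists_between hlt
  have hr₀ : 0 ≤ r := (norm_nonneg _).trans hr.le
  have hpath (s : ℂ) : HasDerivAt (fun s : ℂ ↦ x + s • w) w s := by
    simpa using ((hasDerivAt_id s).smul_const w).const_add x
  have hcont : Continuous fun s : ℂ ↦ x + s • w := by fun_prop
  let S : Set ℂ := {s | ‖x + s • w‖ < r}
  have hSo : IsOpen S := isOpen_lt hcont.norm continuous_const
  obtain ⟨ε, hε, hball⟩ := Metric.isOpen_iff.1 hSo t hr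
  have hterm (s : ℂ) (hs : ‖x + s • w‖ < 1) :
      HasSum (fun n : ℕ ↦ ((-1) ^ n / (n + 1) : ℂ) * τ ((x + s • w) ^ (n + 1)))
        (τ (mercatorSeries (x + s • w))) := by
    simpa [mercatorSeries] using (summable_mercatorSeries hs).hasSum.mapL τ
  have hgeom : τ (v * w) = ∑' n : ℕ, (-1) ^ n * τ ((x + t • w) ^ n * w) := by
    have hneg : ‖-(x + t • w)‖ < 1 := by rwa [norm_neg]
    have hinv : v = ∑' n : ℕ, (-(x + t • w)) ^ n := by
      refine left_inv_eq_right_inv hv ?_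
      simpa only [sub_neg_eq_add] using mul_neg_geom_series _ hneg
    have hs := ((summable_geometric_of_norm_lt_one hneg).hasSum.mul_right w).mapL τ
    rw [hinv, ← hs.tsum_eq]
    refine tsum_congr fun n ↦ ?_
    rw [neg_pow, show ((-1 : A) ^ n) = ((-1 : ℂ) ^ n) • (1 : A) by
      simp [Algebra.smul_def], smul_mul_assoc, one_mul, smul_mul_assoc, map_smul, smul_eq_mul]
  have hbound (n : ℕ) (s : ℂ) (hs : s ∈ Metric.ball t ε) :
      ‖(-1) ^ n * τ ((x + s • w) ^ n * w)‖ ≤ r ^ n * (‖τ‖ * ‖w‖) := by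
    have hpow : ‖(x + s • w) ^ n * w‖ ≤ r ^ n * ‖w‖ := by
      rcases n.eq_zero_or_pos with rfl | hn
      · simp
      · refine (norm_mul_le _ _).trans (mul_le_mul_of_nonneg_right ?_ (norm_nonneg _))
        exact (norm_pow_le' _ hn).trans (pow_le_pow_left₀ (norm_nonneg _) (hball hs).le n)
    rw [norm_mul, norm_pow, norm_neg, norm_one, one_pow, one_mul]
    calc _ ≤ ‖τ‖ * (r ^ n * ‖w‖) := τ.le_opNorm_of_le hpow
      _ = _ := by ring
  have hderiv (n : ℕ) (s : ℂ) (_ : s ∈ Metric.ball t ε) :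
      HasDerivAt (fun s : ℂ ↦ ((-1) ^ n / (n + 1) : ℂ) * τ ((x + s • w) ^ (n + 1)))
        ((-1) ^ n * τ ((x + s • w) ^ n * w)) s := by
    have hn : (n : ℂ) + 1 ≠ 0 := Nat.cast_add_one_ne_zero n
    convert! (hasDerivAt_trace_pow_succ hτ (hpath s) n).const_mul ((-1) ^ n / (n + 1) : ℂ) using 1
    field_simp
  have ht : t ∈ Metric.ball t ε := Metric.mem_ball_self hε
  rw [hgeom]
  refine (hasDerivAt_tsum_of_isPreconnected
    ((summable_geometric_of_lt_one hr₀ hr₁).mul_right (‖τ‖ * ‖w‖)) Metric.isOpen_ball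
    (convex_ball t ε).isPreconnected hderiv hbound ht (hterm t hlt).summable ht).congr_of_eventuallyEq
    ?_
  filter_upwards [Metric.ball_mem_nhds t hε] with s hs
  exact (hterm s ((hball hs).trans hr₁)).tsum_eq.symm

end Derivative

lemma convex_setOf_norm_add_smul_lt {A : Type*} [NormedRing A] [NormedAlgebra ℂ A] (x w : A)
    (r : ℝ) : Convex ℝ {s : ℂ | ‖x + s • w‖ < r} := by
  intro s hs t ht a b ha hb hab
  have h := convex_ball (0 : A) r (mem_ball_zero_iff.2 hs) (mem_ball_zero_iff.2 ht) ha hb hab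
  rw [mem_ball_zero_iff] at h
  refine lt_of_eq_of_lt (congrArg norm ?_) h
  have hx : x = a • x + b • x := by rw [← add_smul, hab, one_smul]
  conv_lhs => rw [hx]
  simp only [smul_add, add_smul, smul_assoc]
  abel

/-- A bounded trace turns the logarithm of `(1 + x) * u` into a sum of logarithms, for `u`
unitary and `(1 + x) * u` close to `1`. -/
lemma trace_mercatorSeries_mul {A : Type*} [CStarAlgebra A] {τ : A →L[ℂ] ℂ}
    (hτ : ∀ a b : A, τ (a * b) = τ (b * a)) {x u : A} (hu : u ∈ unitary A)
    (hlt : ‖x‖ + ‖u - 1‖ < 1) :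
    τ (mercatorSeries ((1 + x) * u - 1)) = τ (mercatorSeries x) + τ (mercatorSeries (u - 1)) := by
  let S : Set ℂ := {s | ‖(u - 1) + s • (x * u)‖ < 1} ∩ {s | ‖0 + s • x‖ < 1}
  have hSo : IsOpen S :=
    (isOpen_lt (by fun_prop) continuous_const).inter (isOpen_lt (by fun_prop) continuous_const)
  have hSc : IsPreconnected S := ((convex_setOf_norm_add_smul_lt _ _ _).inter
    (convex_setOf_norm_add_smul_lt _ _ _)).isPreconnected
  have hxu : ‖x * u‖ = ‖x‖ := CStarRing.norm_mul_mem_unitary x hu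
  have h0 : (0 : ℂ) ∈ S :=
    ⟨by simpa using lt_of_le_of_lt (le_add_of_nonneg_left (norm_nonneg x)) hlt, by simp⟩
  have h1 : (1 : ℂ) ∈ S := by
    constructor
    · have := norm_add_le (u - 1) (x * u)
      simp only [Set.mem_ofPred_eq, one_smul]
      linarith
    · simpa using lt_of_le_of_lt (le_add_of_nonneg_right (norm_nonneg (u - 1))) hlt
  have hd (t : ℂ) (ht : t ∈ S) : HasDerivAt (fun s : ℂ ↦
      τ (mercatorSeries ((u - 1) + s • (x * u))) - τ (mercatorSeries (0 + s • x))) 0 t := by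
    obtain ⟨v, hv⟩ : ∃ v : A, v * (1 + (0 + t • x)) = 1 :=
      ⟨_, by simpa using geom_series_mul_neg (-(0 + t • x)) (by rw [norm_neg]; exact ht.2)⟩
    have hv' : (star u * v) * (1 + ((u - 1) + t • (x * u))) = 1 := by
      have : 1 + ((u - 1) + t • (x * u)) = (1 + (0 + t • x)) * u := by
        rw [zero_add, add_mul, one_mul, smul_mul_assoc]; abel
      rw [this, mul_assoc, ← mul_assoc v, hv, one_mul, Unitary.star_mul_self_of_mem hu]
    have heq : τ (star u * v * (x * u)) = τ (v * x) := by
      rw [mul_assoc, hτ, ← mul_assoc, mul_assoc _ u, Unitary.mul_star_self_of_mem hu, mul_one]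
    convert! (hasDerivAt_trace_mercatorSeries hτ ht.1 hv').sub
      (hasDerivAt_trace_mercatorSeries hτ ht.2 hv) using 1
    rw [heq, sub_self]
  have hconst := hSo.is_const_of_deriv_eq_zero hSc
    (fun t ht ↦ (hd t ht).differentiableAt.differentiableWithinAt)
    (fun t ht ↦ (hd t ht).deriv) h1 h0
  simp only [one_smul, zero_smul, add_zero, zero_add, mercatorSeries_zero, map_zero,
    sub_zero] at hconst
  have : (1 + x) * u - 1 = u - 1 + x * u := by rw [add_mul, one_mul]; abel
  rw [this, ← hconst]
  ring

theorem stmt14 {A : Type*} [CStarAlgebra A] (τ : A →L[ℂ] ℂ)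
    (hτ : IsTracialState τ)
    (huniq : ∀ τ' : A →L[ℂ] ℂ, IsTracialState τ' → τ' = τ)
    (u₁ u₂ : A) (hu₁ : u₁ ∈ unitary A) (hu₂ : u₂ ∈ unitary A)
    (h₁ : ‖u₁ - 1‖ < 1 / 2) (h₂ : ‖u₂ - 1‖ < 1 / 2) :
    τ (cfc Complex.log (u₁ * u₂)) = τ (cfc Complex.log u₁) + τ (cfc Complex.log u₂) := by
  have hnormal {u : A} (hu : u ∈ unitary A) : IsStarNormal u :=
    ⟨(Unitary.star_mul_self_of_mem hu).trans (Unitary.mul_star_self_of_mem hu).symm⟩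
  have hprod : ‖u₁ * u₂ - 1‖ < 1 := by
    have hsplit : u₁ * u₂ - 1 = (u₁ - 1) * u₂ + (u₂ - 1) := by rw [sub_mul, one_mul]; abel
    have := norm_add_le ((u₁ - 1) * u₂) (u₂ - 1)
    rw [CStarRing.norm_mul_mem_unitary _ hu₂] at this
    rw [hsplit]
    linarith
  rw [cfc_log_eq_mercatorSeries (hnormal (mul_mem hu₁ hu₂)) hprod,
    cfc_log_eq_mercatorSeries (hnormal hu₁) (by linarith),
    cfc_log_eq_mercatorSeries (hnormal hu₂) (by linarith)]
  have := trace_mercatorSeries_mul hτ.2.2 (x := u₁ - 1) hu₂ (by linarith)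
  rwa [add_sub_cancel] at this
end

section
/- Let A be a unital C*-algebra which has a unique tracial state τ. If u_1, u_2, v are unitaries in A with ‖u_1 − u_2‖ < 1/2 and ‖v − 1‖ < 1/4, then τ(log(u_1 v u_2* v*)) = τ(log(u_1 u_2*)). (Note ‖u_1 u_2* − 1‖ = ‖u_1 − u_2‖ < 1/2 and ‖u_1 v u_2* v* − 1‖ ≤ 2‖v − 1‖ + ‖u_1 − u_2‖ < 1, so both logarithms are defined.) -/
/- Statement 15: in a unital C*-algebra with a unique tracial state τ, if
   ‖u₁ − u₂‖ < 1/2 and ‖v − 1‖ < 1/4 for unitaries u₁, u₂, v, then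
   τ(log(u₁ v u₂* v*)) = τ(log(u₁ u₂*)). -/

open scoped ComplexOrder

open NormedSpace selfAdjoint Unitary

section LogSeries

variable {A : Type*} [CStarAlgebra A]

/-- The Taylor series of the logarithm at `1` converges, under the continuous functional calculus,
on unitaries at distance less than `1` from the identity. -/
theorem tendsto_sum_cfc_log {w : A} (hw : w ∈ unitary A) (h : ‖w - 1‖ < 1) :
    Filter.Tendsto (fun n : ℕ ↦ ∑ j ∈ Finset.range n, (-((j : ℂ) + 1)⁻¹) • (1 - w) ^ (j + 1))
      Filter.atTop (nhds (cfc Complex.log w)) := by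
  have : IsStarNormal w := isStarNormal_of_mem_unitary hw
  set r := ‖w - 1‖
  have hr0 : 0 ≤ r := norm_nonneg _
  have hspec : ∀ z ∈ spectrum ℂ w, ‖z - 1‖ ≤ r := by
    intro z hz
    have := norm_apply_le_norm_cfc (fun z : ℂ ↦ z - 1) w hz
    rwa [cfc_sub _ _ w, cfc_id' ℂ w, cfc_const_one ℂ w] at this
  have hlog : ContinuousOn Complex.log (spectrum ℂ w) := by
    refine continuousOn_id.clog fun z hz ↦ ?_
    exact (spectrum_subset_slitPlane_iff_norm_lt_two hw).mpr (by linarith) hz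
  have hsum : ∀ n : ℕ, ∑ j ∈ Finset.range n, (-((j : ℂ) + 1)⁻¹) • (1 - w) ^ (j + 1) =
      cfc (fun z ↦ Complex.logTaylor (n + 1) (z - 1)) w := by
    intro n
    have hfun : (fun z ↦ Complex.logTaylor (n + 1) (z - 1)) =
        ∑ j ∈ Finset.range n, fun z : ℂ ↦ (-((j : ℂ) + 1)⁻¹) * (1 - z) ^ (j + 1) := by
      ext z
      rw [Complex.logTaylor, Finset.sum_range_succ']
      simp only [Nat.cast_zero, div_zero, add_zero, Finset.sum_apply]
      refine Finset.sum_congr rfl fun j _ ↦ ?_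
      rw [← neg_sub 1 z, neg_pow (1 - z), ← mul_assoc, ← pow_add,
        show j + 1 + 1 + (j + 1) = 2 * (j + 1) + 1 by ring, pow_succ, pow_mul]
      push_cast
      simp [div_eq_mul_inv, mul_comm]
    rw [hfun, cfc_sum _ _ _ (fun j _ ↦ by fun_prop)]
    refine Finset.sum_congr rfl fun j _ ↦ ?_
    rw [cfc_const_mul _ _ w, cfc_pow _ _ w, cfc_sub _ _ w, cfc_id' ℂ w, cfc_const_one ℂ w]
  rw [tendsto_iff_norm_sub_tendsto_zero]
  have hlim : Filter.Tendsto (fun n : ℕ ↦ r ^ (n + 1) * (1 - r)⁻¹) Filter.atTop (nhds 0) := by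
    simpa using ((tendsto_pow_atTop_nhds_zero_of_lt_one hr0 h).comp
      (Filter.tendsto_add_atTop_nat 1)).mul_const (1 - r)⁻¹
  refine squeeze_zero (fun _ ↦ norm_nonneg _) (fun n ↦ ?_) hlim
  have hr1 : 0 < 1 - r := by linarith
  have hT : Continuous fun z : ℂ ↦ Complex.logTaylor (n + 1) (z - 1) := by
    unfold Complex.logTaylor
    fun_prop
  rw [norm_sub_rev, hsum, ← cfc_sub _ _ w hlog hT.continuousOn]
  refine norm_cfc_le (by positivity) fun z hz ↦ ?_
  have hz' := hspec z hz
  have hz1 : 0 < 1 - ‖z - 1‖ := by linarith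
  have key := Complex.norm_log_sub_logTaylor_le n (hz'.trans_lt h)
  rw [add_sub_cancel] at key
  calc _ ≤ _ := key
    _ ≤ ‖z - 1‖ ^ (n + 1) * (1 - ‖z - 1‖)⁻¹ := by
        refine div_le_self (by positivity) ?_
        linarith [(Nat.cast_nonneg n : (0 : ℝ) ≤ n)]
    _ ≤ r ^ (n + 1) * (1 - r)⁻¹ := by gcongr

/-- The composition of a functional with the Taylor series of the logarithm at `1`. -/
noncomputable def logSeries (τ : A →L[ℂ] ℂ) (a : A) : ℂ :=
  ∑' n : ℕ, τ ((-((n : ℂ) + 1)⁻¹) • (1 - a) ^ (n + 1))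

theorem summable_logSeries (τ : A →L[ℂ] ℂ) {a : A} (h : ‖1 - a‖ < 1) :
    Summable fun n : ℕ ↦ τ ((-((n : ℂ) + 1)⁻¹) • (1 - a) ^ (n + 1)) := by
  have hs := ((summable_geometric_of_lt_one (norm_nonneg _) h).mul_left (‖τ‖ * ‖1 - a‖))
  refine Summable.of_norm_bounded hs fun n ↦ ?_
  refine (τ.le_opNorm _).trans ?_
  rw [mul_assoc, ← pow_succ']
  refine mul_le_mul_of_nonneg_left ?_ (norm_nonneg _)
  rw [norm_smul, norm_neg, norm_inv]
  have h1 : ‖(n : ℂ) + 1‖⁻¹ ≤ 1 := by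
    refine inv_le_one_of_one_le₀ ?_
    rw [← Nat.cast_succ, Complex.norm_natCast]
    exact_mod_cast n.succ_pos
  calc _ ≤ 1 * ‖1 - a‖ ^ (n + 1) :=
        mul_le_mul h1 (norm_pow_le' _ n.succ_pos) (norm_nonneg _) zero_le_one
    _ = _ := one_mul _

theorem apply_cfc_log_eq_logSeries (τ : A →L[ℂ] ℂ) {w : A} (hw : w ∈ unitary A)
    (h : ‖w - 1‖ < 1) : τ (cfc Complex.log w) = logSeries τ w := by
  have h1 := (τ.continuous.tendsto _).comp (tendsto_sum_cfc_log hw h)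
  have h2 := (summable_logSeries τ (a := w) (by rwa [norm_sub_rev])).hasSum.tendsto_sum_nat
  refine tendsto_nhds_unique h1 (h2.congr fun n ↦ ?_)
  simp only [Function.comp_apply, map_sum]

theorem hasFDerivAt_trace_pow {τ : A →L[ℂ] ℂ} (hτ : ∀ a b : A, τ (a * b) = τ (b * a))
    (n : ℕ) (a : A) :
    HasFDerivAt (fun x : A ↦ τ ((-((n : ℂ) + 1)⁻¹) • (1 - x) ^ (n + 1)))
      (τ.comp (ContinuousLinearMap.mul ℂ A ((1 - a) ^ n))) a := by
  have h1 : HasFDerivAt (𝕜 := ℂ) (fun x : A ↦ 1 - x) (-ContinuousLinearMap.id ℂ A) a :=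
    (hasFDerivAt_id a).const_sub 1
  have h2 := τ.hasFDerivAt.comp a ((h1.pow' (n + 1)).const_smul (-((n : ℂ) + 1)⁻¹))
  refine h2.congr_fderiv ?_
  ext h
  have hterm : ∀ i ∈ Finset.range (n + 1),
      τ ((1 - a) ^ (n - i) * h * (1 - a) ^ i) = τ ((1 - a) ^ n * h) := by
    intro i hi
    rw [hτ, ← mul_assoc, ← pow_add,
      Nat.add_sub_cancel' (Nat.lt_succ_iff.mp (Finset.mem_range.mp hi))]
  have hn : (n : ℂ) + 1 ≠ 0 := Nat.cast_add_one_ne_zero n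
  simp [Finset.sum_congr rfl hterm, hn]

/-- A trace of the logarithm has logarithmic derivative `h ↦ τ (a⁻¹ h)`. -/
theorem hasFDerivAt_logSeries {τ : A →L[ℂ] ℂ} (hτ : ∀ a b : A, τ (a * b) = τ (b * a))
    {a b : A} (ha : ‖1 - a‖ < 1) (hab : a * b = 1) :
    HasFDerivAt (logSeries τ) (τ.comp (ContinuousLinearMap.mul ℂ A b)) a := by
  rcases subsingleton_or_nontrivial A with _ | _
  · exact (hasFDerivAt_of_subsingleton _ a).congr_fderiv (by ext h; simp [Subsingleton.elim h 0])
  obtain ⟨r, har, hr1⟩ := exists_between ha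
  have hr0 : 0 ≤ r := (norm_nonneg _).trans har.le
  have hs : HasSum (fun n ↦ τ.comp (ContinuousLinearMap.mul ℂ A ((1 - a) ^ n)))
      (τ.comp (ContinuousLinearMap.mul ℂ A b)) := by
    have hb : ∑' n : ℕ, (1 - a) ^ n = b := by
      have := geom_series_mul_neg (1 - a) ha
      rw [sub_sub_cancel] at this
      exact left_inv_eq_right_inv this hab
    have hg := (summable_geometric_of_norm_lt_one ha).hasSum
    rw [hb] at hg
    exact hg.mapL ((ContinuousLinearMap.compL ℂ A A ℂ τ).comp (ContinuousLinearMap.mul ℂ A))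
  rw [← hs.tsum_eq]
  have mem_ball {x : A} : x ∈ Metric.ball (1 : A) r ↔ ‖1 - x‖ < r := by
    rw [Metric.mem_ball, dist_comm, dist_eq_norm]
  refine hasFDerivAt_tsum_of_isPreconnected
    ((summable_geometric_of_lt_one hr0 hr1).mul_left ‖τ‖) (Metric.isOpen_ball (x := (1 : A)))
    (convex_ball (1 : A) r).isPreconnected (fun n x _ ↦ hasFDerivAt_trace_pow hτ n x)
    (fun n x hx ↦ ?_) (mem_ball.mpr har) (summable_logSeries τ ha) (mem_ball.mpr har)
  refine (ContinuousLinearMap.opNorm_comp_le _ _).trans ?_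
  gcongr
  refine (ContinuousLinearMap.opNorm_mul_apply_le ℂ A _).trans ((norm_pow_le _ n).trans ?_)
  gcongr
  exact (mem_ball.mp hx).le

end LogSeries

theorem norm_twisted_commutator_sub_one_le {A : Type*} [CStarAlgebra A] {u₁ u₂ v : A}
    (hu₁ : u₁ ∈ unitary A) (hu₂ : u₂ ∈ unitary A) (hv : v ∈ unitary A) :
    ‖u₁ * v * star u₂ * star v - 1‖ ≤ 2 * ‖v - 1‖ + ‖u₁ - u₂‖ := by
  have hvu : v * u₂ ∈ unitary A := mul_mem hv hu₂
  have h1 : u₁ * v * star u₂ * star v - 1 =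
      (u₁ * (v - 1) - (v - 1) * u₂ + (u₁ - u₂)) * star (v * u₂) := by
    have : u₁ * (v - 1) - (v - 1) * u₂ + (u₁ - u₂) = u₁ * v - v * u₂ := by noncomm_ring
    rw [this, sub_mul, Unitary.mul_star_self_of_mem hvu, star_mul]
    simp only [mul_assoc]
  rw [h1, CStarRing.norm_mul_mem_unitary _ (star_mem hvu)]
  calc _ ≤ ‖u₁ * (v - 1)‖ + ‖(v - 1) * u₂‖ + ‖u₁ - u₂‖ :=
        (norm_add_le _ _).trans (add_le_add_left (norm_sub_le _ _) _)
    _ = _ := by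
      rw [CStarRing.norm_mem_unitary_mul _ hu₁, CStarRing.norm_mul_mem_unitary _ hu₂]
      ring

theorem stmt15 {A : Type*} [CStarAlgebra A] (τ : A →L[ℂ] ℂ)
    (hτ : IsTracialState τ)
    (huniq : ∀ τ' : A →L[ℂ] ℂ, IsTracialState τ' → τ' = τ)
    (u₁ u₂ v : A) (hu₁ : u₁ ∈ unitary A) (hu₂ : u₂ ∈ unitary A) (hv : v ∈ unitary A)
    (h₁₂ : ‖u₁ - u₂‖ < 1 / 2) (hv1 : ‖v - 1‖ < 1 / 4) :
    τ (cfc Complex.log (u₁ * v * star u₂ * star v)) =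
      τ (cfc Complex.log (u₁ * star u₂)) := by
  obtain ⟨-, -, htr⟩ := hτ
  let x : selfAdjoint A := argSelfAdjoint ⟨v, hv⟩
  let y : A := Complex.I • (x : A)
  have hy : star y = -y := by simp [y, x.2.star_eq]
  let V : ℝ → A := fun t ↦ exp (t • y)
  have hV : ∀ t, V t = expUnitary (t • x) := fun t ↦ by
    simp [V, y, smul_comm t Complex.I]
  have hVu : ∀ t, V t ∈ unitary A := fun t ↦ hV t ▸ (expUnitary (t • x)).2
  have hV0 : V 0 = 1 := by simp [V]
  have hV1 : V 1 = v := by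
    rw [hV, one_smul, expUnitary_argSelfAdjoint (by simpa using by linarith)]
  have hVn : ∀ t ∈ Set.Icc (0 : ℝ) 1, ‖V t - 1‖ < 1 / 4 := fun t ht ↦ by
    rw [hV]
    exact (norm_expUnitary_smul_argSelfAdjoint_sub_one_le ⟨v, hv⟩ ht
      (hv1.trans (by norm_num))).trans_lt hv1
  have hVd : ∀ t, HasDerivAt V (V t * y) t := hasDerivAt_exp_smul_const y
  have hVd' : ∀ t, HasDerivAt (fun s ↦ star (V s)) (-(y * star (V t))) t := fun t ↦ by
    simpa [hy] using (hVd t).star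
  let W : ℝ → A := fun t ↦ u₁ * V t * star u₂ * star (V t)
  have hWu : ∀ t, W t ∈ unitary A := fun t ↦
    mul_mem (mul_mem (mul_mem hu₁ (hVu t)) (star_mem hu₂)) (star_mem (hVu t))
  have hWn : ∀ t ∈ Set.Icc (0 : ℝ) 1, ‖W t - 1‖ < 1 := fun t ht ↦ by
    have := norm_twisted_commutator_sub_one_le hu₁ hu₂ (hVu t)
    linarith [hVn t ht]
  have hd : ∀ t ∈ Set.Icc (0 : ℝ) 1, HasDerivAt (fun s ↦ logSeries τ (W s)) 0 t := by
    intro t ht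
    have hWd : HasDerivAt W
        (u₁ * (V t * y) * star u₂ * star (V t) + u₁ * V t * star u₂ * -(y * star (V t))) t :=
      (((hVd t).const_mul u₁).mul_const (star u₂)).mul (hVd' t)
    have hF := (hasFDerivAt_logSeries htr (a := W t) (b := star (W t))
      (by rw [norm_sub_rev]; exact hWn t ht)
      (Unitary.mul_star_self_of_mem (hWu t))).restrictScalars ℝ
    refine (hF.comp_hasDerivAt t hWd).congr_deriv ?_
    have c1 : ∀ c : A, star u₁ * (u₁ * c) = c := fun c ↦ by
      rw [← mul_assoc, Unitary.star_mul_self_of_mem hu₁, one_mul]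
    have c2 : ∀ c : A, u₂ * (star u₂ * c) = c := fun c ↦ by
      rw [← mul_assoc, Unitary.mul_star_self_of_mem hu₂, one_mul]
    have c3 : ∀ c : A, star (V t) * (V t * c) = c := fun c ↦ by
      rw [← mul_assoc, Unitary.star_mul_self_of_mem (hVu t), one_mul]
    have e1 : star (W t) * (u₁ * (V t * y) * star u₂ * star (V t)) =
        V t * u₂ * (y * star u₂ * star (V t)) := by
      simp [W, mul_assoc, c1, c3]
    have e2 : star (W t) * (u₁ * V t * star u₂ * -(y * star (V t))) =
        -(V t * (y * star (V t))) := by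
      simp [W, mul_assoc, c1, c2, c3]
    have f1 : τ (V t * u₂ * (y * star u₂ * star (V t))) = τ y := by
      rw [htr]
      simp [mul_assoc, c3, Unitary.star_mul_self_of_mem hu₂]
    have f2 : τ (V t * (y * star (V t))) = τ y := by
      rw [htr]
      simp [mul_assoc, Unitary.star_mul_self_of_mem (hVu t)]
    change τ (star (W t) * _) = 0
    rw [mul_add, e1, e2, map_add, map_neg, f1, f2, add_neg_cancel]
  have hconst := constant_of_has_deriv_right_zero (a := (0 : ℝ)) (b := 1)
    (fun t ht ↦ (hd t ht).continuousAt.continuousWithinAt)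
    (fun t ht ↦ (hd t (Set.Ico_subset_Icc_self ht)).hasDerivWithinAt) 1
    (Set.right_mem_Icc.mpr zero_le_one)
  have hlog : ∀ t ∈ Set.Icc (0 : ℝ) 1, τ (cfc Complex.log (W t)) = logSeries τ (W t) :=
    fun t ht ↦ apply_cfc_log_eq_logSeries τ (hWu t) (hWn t ht)
  have h0 := hlog 0 (Set.left_mem_Icc.mpr zero_le_one)
  have h1 := hlog 1 (Set.right_mem_Icc.mpr zero_le_one)
  have e : τ (cfc Complex.log (W 1)) = τ (cfc Complex.log (W 0)) := by rw [h0, h1, hconst]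
  simpa [W, hV0, hV1] using e
end
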